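/- arXiv:1302.0017 — 5 statements merged into one kernel-verified Lean document; each statement's English description precedes it below -/
import Mathlib

section
/- Let ζ > 0, ω_n > 0, and a_p, θ_max ∈ ℝ. Consider the cubic polynomial q_c(s) = s³ + a₁s² + a₂s + a₃ with real coefficients a₁ = 2ζω_n − a_p, a₂ = ω_n² − 2a_p ζ ω_n, a₃ = (θ_max − a_p)ω_n². Then every complex root of q_c has negative real part if and only if the following three conditions hold: (i) a_p < min(2ζω_n, ω_n/(2ζ)); (ii) θ_max > a_p; (iii) θ_max < −4a_p ζ² + 2ζa_p²/ω_n + 2ζω_n. -/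
theorem cubic_real_root (a b c : ℝ) : ∃ r : ℝ, r ^ 3 + a * r ^ 2 + b * r + c = 0 := by
  set M : ℝ := 1 + |a| + |b| + |c| with hM
  have ha := abs_nonneg a
  have hb := abs_nonneg b
  have hc := abs_nonneg c
  have ha1 := neg_abs_le a
  have ha2 := le_abs_self a
  have hb1 := neg_abs_le b
  have hb2 := le_abs_self b
  have hc1 := neg_abs_le c
  have hc2 := le_abs_self c
  have hM1 : 1 ≤ M := by linarith
  have hM2 : M ≤ M ^ 2 := by nlinarith
  have hM3 : 1 ≤ M ^ 2 := by linarith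
  have e : M ^ 3 = M ^ 2 + |a| * M ^ 2 + |b| * M ^ 2 + |c| * M ^ 2 := by
    have : M ^ 3 = M * M ^ 2 := by ring
    rw [this]; nth_rewrite 1 [hM]; ring
  have e1 : |b| * M ≤ |b| * M ^ 2 := mul_le_mul_of_nonneg_left hM2 hb
  have e2 : |c| * 1 ≤ |c| * M ^ 2 := mul_le_mul_of_nonneg_left hM3 hc
  have p1 : a * M ^ 2 ≤ |a| * M ^ 2 := mul_le_mul_of_nonneg_right ha2 (by positivity)
  have p2 : -|a| * M ^ 2 ≤ a * M ^ 2 := mul_le_mul_of_nonneg_right ha1 (by positivity)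
  have q1 : b * M ≤ |b| * M := mul_le_mul_of_nonneg_right hb2 (by linarith)
  have q2 : -|b| * M ≤ b * M := mul_le_mul_of_nonneg_right hb1 (by linarith)
  have hcont : ContinuousOn (fun r : ℝ => r ^ 3 + a * r ^ 2 + b * r + c) (Set.Icc (-M) M) := by
    fun_prop
  have := intermediate_value_Icc (by linarith : -M ≤ M) hcont
  obtain ⟨r, -, hr⟩ := this (show (0 : ℝ) ∈ _ from by
    constructor
    · have : (-M) ^ 3 = -M ^ 3 := by ring
      have h2 : (-M) ^ 2 = M ^ 2 := by ring
      simp only [this, h2]; linarith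
    · linarith)
  exact ⟨r, hr⟩

theorem quad_hurwitz (b c : ℝ)
    (h : ∀ z : ℂ, z ^ 2 + (b : ℂ) * z + (c : ℂ) = 0 → z.re < 0) : 0 < b ∧ 0 < c := by
  obtain ⟨d, hd⟩ := IsAlgClosed.exists_pow_nat_eq ((b : ℂ) ^ 2 - 4 * c) (n := 2) (by norm_num)
  obtain ⟨w, hw⟩ : ∃ w : ℂ, w ^ 2 + (b : ℂ) * w + (c : ℂ) = 0 :=
    ⟨(-b + d) / 2, by linear_combination (1 / 4 : ℂ) * hd⟩
  have h1 := h w hw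
  have h2 := h (-b - w) (by linear_combination hw)
  simp only [Complex.sub_re, Complex.neg_re, Complex.ofReal_re] at h2
  have hre := congrArg Complex.re hw
  have him := congrArg Complex.im hw
  simp [pow_two] at hre him
  refine ⟨by linarith, ?_⟩
  have him' : w.im * (2 * w.re + b) = 0 := by linarith
  rcases mul_eq_zero.mp him' with h0 | h0
  · rw [h0] at hre
    nlinarith
  · have : b = -2 * w.re := by linarith
    subst this
    nlinarith [sq_nonneg w.im, mul_pos_of_neg_of_neg h1 h1]

theorem cubic_hurwitz (a b c : ℝ) :
    (∀ z : ℂ, z ^ 3 + (a : ℂ) * z ^ 2 + (b : ℂ) * z + (c : ℂ) = 0 → z.re < 0) ↔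
      (0 < a ∧ 0 < b ∧ 0 < c ∧ c < a * b) := by
  constructor
  · intro h
    obtain ⟨r, hr⟩ := cubic_real_root a b c
    have hrC : (r : ℂ) ^ 3 + (a : ℂ) * r ^ 2 + (b : ℂ) * r + (c : ℂ) = 0 := by exact_mod_cast hr
    have hr0 : r < 0 := by simpa using h r hrC
    obtain ⟨hB, hC⟩ := quad_hurwitz (a + r) (b + r * (a + r)) (by
      intro z hz
      apply h
      push_cast at hz
      linear_combination (z - r) * hz + hrC)
    obtain ⟨B, hBe⟩ : ∃ B, B = a + r := ⟨_, rfl⟩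
    obtain ⟨C, hCe⟩ : ∃ C, C = b + r * (a + r) := ⟨_, rfl⟩
    obtain ⟨p, hp⟩ : ∃ p, p = -r := ⟨_, rfl⟩
    rw [← hBe] at hB
    rw [← hCe] at hC
    have hp0 : 0 < p := by linarith
    have ea : a = B + p := by linarith
    have eb : b = C + p * B := by subst hp hBe hCe; ring
    have ec : c = p * C := by subst hp hBe hCe; linarith
    rw [ea, eb, ec]
    refine ⟨by positivity, by positivity, by positivity, ?_⟩
    have : 0 < B * (C + p * B + p ^ 2) := by positivity
    linarith
  · rintro ⟨ha, hb, hc, hab⟩ z hz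
    by_contra! hx
    have hre := congrArg Complex.re hz
    have him := congrArg Complex.im hz
    simp [pow_succ] at hre him
    generalize z.re = x at *
    generalize z.im = y at *
    have him' : y * (3 * x ^ 2 - y ^ 2 + 2 * a * x + b) = 0 := by linarith
    rcases mul_eq_zero.mp him' with h0 | h0
    · subst h0
      have : 0 < x ^ 3 + a * x ^ 2 + b * x + c := by positivity
      linarith
    · have : 0 ≤ 8 * x ^ 3 + 8 * a * x ^ 2 + 2 * (a ^ 2 + b) * x := by positivity
      have key : 8 * x ^ 3 + 8 * a * x ^ 2 + 2 * (a ^ 2 + b) * x + (a * b - c) = 0 := by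
        linear_combination -hre + (3 * x + a) * h0
      linarith

/-- Routh–Hurwitz analysis of the closed-loop cubic
`q_c(s) = s³ + (2ζω_n − a_p)s² + (ω_n² − 2a_pζω_n)s + (θmax − a_p)ω_n²`:
all its complex roots have negative real part iff conditions (A-i)–(A-iii) hold. -/
theorem cubic_hurwitz_iff_conditions
    (ζ ωn ap θmax : ℝ) (hζ : 0 < ζ) (hωn : 0 < ωn) :
    (∀ z : ℂ,
        z ^ 3 + ((2 * ζ * ωn - ap : ℝ) : ℂ) * z ^ 2
          + ((ωn ^ 2 - 2 * ap * ζ * ωn : ℝ) : ℂ) * z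
          + (((θmax - ap) * ωn ^ 2 : ℝ) : ℂ) = 0 → z.re < 0)
      ↔
    (ap < min (2 * ζ * ωn) (ωn / (2 * ζ)) ∧
      θmax > ap ∧
      θmax < -4 * ap * ζ ^ 2 + 2 * ζ * ap ^ 2 / ωn + 2 * ζ * ωn) := by
  rw [cubic_hurwitz, lt_min_iff, lt_div_iff₀ (by positivity)]
  have k1 : 0 < ωn ^ 2 - 2 * ap * ζ * ωn ↔ ap * (2 * ζ) < ωn := by
    have : ωn ^ 2 - 2 * ap * ζ * ωn = ωn * (ωn - ap * (2 * ζ)) := by ring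
    rw [this, mul_pos_iff_of_pos_left hωn, sub_pos]
  have k2 : 0 < (θmax - ap) * ωn ^ 2 ↔ θmax > ap := by
    rw [mul_pos_iff_of_pos_right (by positivity), sub_pos]
  have k3 : (θmax - ap) * ωn ^ 2 < (2 * ζ * ωn - ap) * (ωn ^ 2 - 2 * ap * ζ * ωn) ↔
      θmax < -4 * ap * ζ ^ 2 + 2 * ζ * ap ^ 2 / ωn + 2 * ζ * ωn := by
    have : (2 * ζ * ωn - ap) * (ωn ^ 2 - 2 * ap * ζ * ωn) - (θmax - ap) * ωn ^ 2 =
        (-4 * ap * ζ ^ 2 + 2 * ζ * ap ^ 2 / ωn + 2 * ζ * ωn - θmax) * ωn ^ 2 := by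
      field_simp
      ring
    rw [← sub_pos, this, mul_pos_iff_of_pos_right (by positivity), sub_pos]
  rw [k1, k2, k3, sub_pos, and_assoc]
end

section
/- Let b₀ > 0, b₁ > 0, δ > 0, and ē > δ, and set ΔT = δ/(b₀ē + b₁); assume b₀ΔT < 1. Let e : [t_a, t_a + ΔT] → ℝ be continuous, differentiable on the interval, with |e(t_a)| = ē − δ, and suppose that |e'(t)| ≤ b₀·ē' + b₁ for all t ∈ [t_a, t_a + ΔT], where ē' = sup_{t ∈ [t_a, t_a+ΔT]} |e(t)|. Then |e(t)| ≤ ē for all t ∈ [t_a, t_a + ΔT]. -/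
/-- Proposition 1(i): a self-bounding estimate on the tracking error `e(t)` over a time
window `ΔT = δ/(b₀ē + b₁)`; with `ē' = sup_{[t_a, t_a+ΔT]} |e|` and `|e'| ≤ b₀ē' + b₁`
on the window, starting from `|e(t_a)| = ē − δ` one has `|e(t)| ≤ ē` on the window. -/
theorem error_bounded_on_window
    (b₀ b₁ δ ebar ta : ℝ) (hb₀ : 0 < b₀) (hb₁ : 0 < b₁) (hδ : 0 < δ) (hebar : δ < ebar)
    (ΔT : ℝ) (hΔT : ΔT = δ / (b₀ * ebar + b₁)) (hsmall : b₀ * ΔT < 1)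
    (e : ℝ → ℝ)
    (hcont : ContinuousOn e (Set.Icc ta (ta + ΔT)))
    (hdiff : ∀ t ∈ Set.Icc ta (ta + ΔT), DifferentiableAt ℝ e t)
    (hinit : |e ta| = ebar - δ)
    (ebar' : ℝ) (hebar' : ebar' = sSup ((fun t => |e t|) '' Set.Icc ta (ta + ΔT)))
    (hderiv : ∀ t ∈ Set.Icc ta (ta + ΔT), |deriv e t| ≤ b₀ * ebar' + b₁) :
    ∀ t ∈ Set.Icc ta (ta + ΔT), |e t| ≤ ebar := by
  have hpos : 0 < b₀ * ebar + b₁ := by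
    have : 0 < b₀ * ebar := mul_pos hb₀ (hδ.trans hebar)
    linarith
  have hT : 0 < ΔT := by rw [hΔT]; exact div_pos hδ hpos
  have hδ_eq : ΔT * (b₀ * ebar + b₁) = δ := by
    rw [hΔT]; exact div_mul_cancel₀ _ hpos.ne'
  have hta : ta ∈ Set.Icc ta (ta + ΔT) := ⟨le_refl _, by linarith⟩
  have hcpt : IsCompact ((fun t => |e t|) '' Set.Icc ta (ta + ΔT)) :=
    isCompact_Icc.image_of_continuousOn hcont.abs
  have hub : ∀ t ∈ Set.Icc ta (ta + ΔT), |e t| ≤ ebar' := by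
    intro t ht
    rw [hebar']
    exact le_csSup hcpt.bddAbove ⟨t, ht, rfl⟩
  have hC : 0 ≤ b₀ * ebar' + b₁ := (abs_nonneg _).trans (hderiv ta hta)
  have hgrow : ∀ t ∈ Set.Icc ta (ta + ΔT),
      |e t| ≤ (ebar - δ) + (b₀ * ebar' + b₁) * ΔT := by
    intro t ht
    have h1 : ‖e t - e ta‖ ≤ (b₀ * ebar' + b₁) * ‖t - ta‖ :=
      (convex_Icc ta (ta + ΔT)).norm_image_sub_le_of_norm_deriv_le hdiff
        (fun x hx => hderiv x hx) hta ht
    rw [Real.norm_eq_abs, Real.norm_eq_abs, abs_of_nonneg (by linarith [ht.1] : 0 ≤ t - ta)] at h1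
    have h2 : (b₀ * ebar' + b₁) * (t - ta) ≤ (b₀ * ebar' + b₁) * ΔT :=
      mul_le_mul_of_nonneg_left (by linarith [ht.2]) hC
    have h3 := abs_sub_abs_le_abs_sub (e t) (e ta)
    linarith
  have hsup : ebar' ≤ (ebar - δ) + (b₀ * ebar' + b₁) * ΔT := by
    conv_lhs => rw [hebar']
    refine csSup_le (Set.Nonempty.image _ ⟨ta, hta⟩) ?_
    rintro _ ⟨t, ht, rfl⟩
    exact hgrow t ht
  have hle : ebar' ≤ ebar := by
    by_contra! h
    have : 0 < (1 - b₀ * ΔT) * (ebar' - ebar) := mul_pos (by linarith) (by linarith)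
    nlinarith
  intro t ht
  exact (hub t ht).trans hle
end

section
/- Let θ'_max > 0, ε₀ > 0, θ_max = θ'_max + ε₀, c ∈ (0,1), and ξ₀ = c·ε₀. Then for every θ ∈ ℝ with −θ_max + ξ₀ ≤ θ < −θ'_max and every y ∈ ℝ with y ≠ 0, the projection operator satisfies |Proj(θ, y)| > c·|y|. -/
/-- The projection operator with parameters `0 < θ'max < θmax`:
`Proj (θ, y) = ((θmax² − θ²)/(θmax² − θ'max²))·y` if `θ'max < |θ| ≤ θmax` and `y·θ > 0`,
and `Proj (θ, y) = y` otherwise. -/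
noncomputable def Proj (θ'max θmax θ y : ℝ) : ℝ :=
  if θ'max < |θ| ∧ |θ| ≤ θmax ∧ y * θ > 0 then
    ((θmax ^ 2 - θ ^ 2) / (θmax ^ 2 - θ'max ^ 2)) * y
  else y

/-- On the upper part `Ω_u = {θ : −θmax + ξ₀ ≤ θ < −θ'max}` of the lower boundary layer,
the projection operator satisfies `|Proj(θ,y)| > c·|y|` for every `y ≠ 0`. -/
theorem projection_lower_bound_on_omega_u
    (θ'max ε₀ θmax c ξ₀ : ℝ)
    (hθ'pos : 0 < θ'max) (hε₀ : 0 < ε₀) (hθmax : θmax = θ'max + ε₀)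
    (hc : c ∈ Set.Ioo (0 : ℝ) 1) (hξ₀ : ξ₀ = c * ε₀)
    (θ y : ℝ) (hθl : -θmax + ξ₀ ≤ θ) (hθu : θ < -θ'max) (hy : y ≠ 0) :
    c * |y| < |Proj θ'max θmax θ y| := by
  obtain ⟨hc0, hc1⟩ := hc
  have hy' : 0 < |y| := abs_pos.mpr hy
  unfold Proj
  split_ifs with h
  · have hd : 0 < θmax ^ 2 - θ'max ^ 2 := by subst hθmax; nlinarith
    have hk : c < (θmax ^ 2 - θ ^ 2) / (θmax ^ 2 - θ'max ^ 2) := by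
      rw [lt_div_iff₀ hd]
      subst hθmax hξ₀
      have h1 : 0 < c * ε₀ := mul_pos hc0 hε₀
      have h2 : 0 < (c * ε₀) * (-θ'max - θ) := mul_pos h1 (by linarith)
      have h3 : 0 ≤ (θ + (θ'max + ε₀) - c * ε₀) * (θ'max + ε₀ - θ) :=
        mul_nonneg (by linarith) (by linarith)
      nlinarith
    rw [abs_mul]
    exact mul_lt_mul_of_pos_right (hk.trans_le (le_abs_self _)) hy'
  · nlinarith
end

section
/- Let 0 < θ'_max < θ_max with θ_max = θ'_max + ε₀ for some ε₀ > 0, let ξ₀ ∈ (0, ε₀), let γ > 0, let x_p, x_m : ℝ → ℝ be continuous with |x_m(t)| ≤ x̄_m for all t, set e = x_p − x_m, and let θ : ℝ → ℝ be differentiable and satisfy θ̇(t) = γ·Proj(θ(t), −x_p(t)e(t)). Suppose θ(t) ≤ −θ_max + ξ₀ for all t ∈ [t_c, t_d) and θ(t_d) = −θ_max + ξ₀, where t_d > t_c. Then |e(t_d)| ≤ x̄_m. -/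
/-- Proposition 2: if the adaptive parameter stays in the innermost boundary layer
`Ω_l = {θ : −θmax ≤ θ ≤ −θmax + ξ₀}` on `[t_c, t_d)` and leaves it at `t_d`
(i.e. `θ(t_d) = −θmax + ξ₀`), then `|e(t_d)| ≤ x̄_m`. -/
theorem error_bound_at_exit_of_inner_layer
    (θ'max ε₀ θmax ξ₀ γ xbarm tc td : ℝ)
    (hθ'pos : 0 < θ'max) (hε₀ : 0 < ε₀) (hθmax : θmax = θ'max + ε₀)
    (hξ₀ : ξ₀ ∈ Set.Ioo 0 ε₀) (hγ : 0 < γ)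
    (xp xm : ℝ → ℝ) (hxp : Continuous xp) (hxm : Continuous xm)
    (hxmb : ∀ t, |xm t| ≤ xbarm)
    (e : ℝ → ℝ) (he : e = xp - xm)
    (θ : ℝ → ℝ) (hθdiff : Differentiable ℝ θ)
    (hlaw : ∀ t, deriv θ t = γ * Proj θ'max θmax (θ t) (-(xp t * e t)))
    (htctd : tc < td)
    (hbelow : ∀ t ∈ Set.Ico tc td, θ t ≤ -θmax + ξ₀)
    (hexit : θ td = -θmax + ξ₀) :
    |e td| ≤ xbarm := by
  have hd : 0 ≤ deriv θ td := by
    have h := (hasDerivAt_iff_tendsto_slope.1 (hθdiff td).hasDerivAt).mono_left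
      (nhdsWithin_mono td (fun x (hx : x ∈ Set.Iio td) => ne_of_lt hx))
    refine ge_of_tendsto h ?_
    filter_upwards [Ico_mem_nhdsLT htctd] with t ht
    rw [slope_def_field, hexit]
    have h1 := hbelow t ht
    have h2 := ht.2
    exact div_nonneg_of_nonpos (by linarith) (by linarith)
  obtain ⟨hξ1, hξ2⟩ := hξ₀
  have hy : 0 ≤ -(xp td * e td) := by
    by_contra hneg
    push Not at hneg
    have hab : |θ td| = θmax - ξ₀ := by
      rw [hexit, abs_of_neg (by linarith)]; ring
    have hθneg : θ td < 0 := by rw [hexit]; linarith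
    rw [hlaw, Proj, if_pos ⟨by linarith, by linarith, mul_pos_of_neg_of_neg hneg hθneg⟩] at hd
    have hc : 0 < (θmax ^ 2 - θ td ^ 2) / (θmax ^ 2 - θ'max ^ 2) := by
      rw [hexit]
      apply div_pos <;> nlinarith
    have := mul_neg_of_pos_of_neg hγ (mul_neg_of_pos_of_neg hc hneg)
    linarith
  have hxpe : xp td = e td + xm td := by rw [he]; simp
  rw [hxpe] at hy
  by_contra hlt
  push Not at hlt
  have hm := hxmb td
  have h0 : 0 ≤ |xm td| := abs_nonneg _
  have h1 : -(xm td * e td) ≤ |xm td| * |e td| := by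
    rw [← abs_mul]; exact neg_le_abs _
  have h2 : |e td| * |e td| = e td * e td := abs_mul_abs_self _
  nlinarith
end

section
/- Let θ ∈ ℝ. Every complex root of the cubic polynomial s³ + 31s² + 259s + (229 + 458θ) has negative real part if and only if −1/2 < θ < 3900/229. -/
/-- Stability analysis of the Rohrs-counterexample closed loop: every complex root of
`s³ + 31s² + 259s + (229 + 458θ)` has negative real part iff `−1/2 < θ < 3900/229`. -/
theorem rohrs_closed_loop_hurwitz_iff (θ : ℝ) :
    (∀ z : ℂ, z ^ 3 + 31 * z ^ 2 + 259 * z + ((229 + 458 * θ : ℝ) : ℂ) = 0 → z.re < 0)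
      ↔ (-1 / 2 < θ ∧ θ < 3900 / 229) := by
  obtain ⟨c, hc⟩ : ∃ c : ℝ, c = 229 + 458 * θ := ⟨_, rfl⟩
  rw [← hc]
  have hcont : Continuous (fun x : ℝ => x ^ 3 + 31 * x ^ 2 + 259 * x + c) := by fun_prop
  constructor
  · intro h
    constructor
    · by_contra hn
      have hc0 : c ≤ 0 := by linarith
      have hivt := intermediate_value_Icc (show (0 : ℝ) ≤ -c by linarith) hcont.continuousOn
      have hmem : (0 : ℝ) ∈ Set.Icc ((0 : ℝ) ^ 3 + 31 * 0 ^ 2 + 259 * 0 + c)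
          ((-c) ^ 3 + 31 * (-c) ^ 2 + 259 * (-c) + c) := by
        have h3 : 0 ≤ (-c) ^ 3 := pow_nonneg (by linarith) 3
        constructor
        · linarith
        · nlinarith [sq_nonneg c]
      obtain ⟨r, hr, hr0⟩ := hivt hmem
      have h1 := h (r : ℂ) (by
        have h2 : r ^ 3 + 31 * r ^ 2 + 259 * r + c = 0 := hr0
        exact_mod_cast h2)
      rw [Complex.ofReal_re] at h1
      linarith [hr.1]
    · by_contra hn
      have hc0 : 8029 ≤ c := by linarith
      have hivt := intermediate_value_Icc (show -c ≤ (-31 : ℝ) by linarith) hcont.continuousOn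
      have hmem : (0 : ℝ) ∈ Set.Icc ((-c) ^ 3 + 31 * (-c) ^ 2 + 259 * (-c) + c)
          ((-31 : ℝ) ^ 3 + 31 * (-31) ^ 2 + 259 * (-31) + c) := by
        constructor
        · have : 0 ≤ c ^ 2 * (c - 31) := mul_nonneg (sq_nonneg c) (by linarith)
          nlinarith
        · linarith
      obtain ⟨r, hr, hr0⟩ := hivt hmem
      have h2 : r ^ 3 + 31 * r ^ 2 + 259 * r + c = 0 := hr0
      have h2' : (r : ℂ) ^ 3 + 31 * (r : ℂ) ^ 2 + 259 * (r : ℂ) + (c : ℂ) = 0 := by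
        exact_mod_cast h2
      obtain ⟨w, hw, hwre⟩ : ∃ w : ℂ,
          w ^ 2 = (31 + (r : ℂ)) ^ 2 - 4 * (259 + r * (31 + r)) ∧ 0 ≤ w.re := by
        obtain ⟨w, hw⟩ := IsAlgClosed.exists_pow_nat_eq
          ((31 + (r : ℂ)) ^ 2 - 4 * (259 + r * (31 + r))) (n := 2) (by norm_num)
        rcases le_total 0 w.re with h0 | h0
        · exact ⟨w, hw, h0⟩
        · exact ⟨-w, by rw [neg_sq, hw], by rw [Complex.neg_re]; linarith⟩
      have h1 := h (((-(31 + r) / 2 : ℝ) : ℂ) + ((1 / 2 : ℝ) : ℂ) * w) (by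
        push_cast
        linear_combination h2' + ((-(31 + (r : ℂ)) / 2 + 1 / 2 * w) - r) / 4 * hw)
      rw [Complex.add_re, Complex.re_ofReal_mul, Complex.ofReal_re] at h1
      linarith [hr.2]
  · rintro ⟨h1, h2⟩ z hz
    by_contra hn
    have hx : 0 ≤ z.re := not_lt.mp hn
    have hcp : 0 < c := by linarith
    have hcl : c < 8029 := by linarith
    obtain ⟨x, y⟩ := z
    have hre := congrArg Complex.re hz
    have him := congrArg Complex.im hz
    simp [pow_succ] at hre him hx
    have him' : y * (3 * x ^ 2 - y ^ 2 + 62 * x + 259) = 0 := by linear_combination him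
    have hre' : x ^ 3 - 3 * x * y ^ 2 + 31 * x ^ 2 - 31 * y ^ 2 + 259 * x + c = 0 := by
      linear_combination hre
    have hx2 : 0 ≤ x ^ 2 := by positivity
    have hx3 : 0 ≤ x ^ 3 := by positivity
    rcases mul_eq_zero.mp him' with h0 | h0
    · subst h0
      nlinarith
    · have hy : y ^ 2 = 3 * x ^ 2 + 62 * x + 259 := by linarith
      rw [show x ^ 3 - 3 * x * y ^ 2 + 31 * x ^ 2 - 31 * y ^ 2 + 259 * x + c
        = x ^ 3 + 31 * x ^ 2 + 259 * x + c - (3 * x + 31) * y ^ 2 by ring, hy] at hre'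
      nlinarith
end
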